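/- arXiv:1902.08007 — 6 statements merged into one kernel-verified Lean document; each statement's English description precedes it below -/
import Mathlib

section
/- Let q be a prime power, n ≥ 1, and let f(x) = xM be a field linear network over GF(q) given by a matrix M ∈ GF(q)^{n×n}. Then the following are equivalent: (1) f is expansive; (2) M is nonsingular and N_u^{(0)} is nonsingular for all u ∈ [n]; (3) N_u^{(t)} is nonsingular for all u ∈ [n] and all t ≥ 1; (4) there exists t ≥ 1 such that N_u^{(t)} is nonsingular for all u ∈ [n]. -/
/-- An automata network `f` on `n` nodes over alphabet `α` is *expansive* if for all
distinct configurations `x, y` and every node `v` there exists `t ≥ 1` with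
`f^t(x)_v ≠ f^t(y)_v`. -/
def Expansive {n : ℕ} {α : Type*} (f : (Fin n → α) → (Fin n → α)) : Prop :=
  ∀ x y : Fin n → α, x ≠ y → ∀ v : Fin n, ∃ t : ℕ, 1 ≤ t ∧ f^[t] x v ≠ f^[t] y v

/-- The matrix `N_u^{(t)}` whose `j`-th column (`j = 0, …, n-1`) is the `u`-th column of
the matrix power `M^{t+j}`. -/
def Nmat {n : ℕ} {F : Type*} [Field F] (M : Matrix (Fin n) (Fin n) F) (t : ℕ) (u : Fin n) :
    Matrix (Fin n) (Fin n) F :=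
  Matrix.of fun i j => (M ^ (t + (j : ℕ))) i u

theorem Nmat_eq_pow_mul {n : ℕ} {F : Type*} [Field F] (M : Matrix (Fin n) (Fin n) F)
    (t : ℕ) (u : Fin n) : Nmat M t u = M ^ t * Nmat M 0 u := by
  ext i j
  simp [Nmat, pow_add, Matrix.mul_apply]

theorem det_Nmat {n : ℕ} {F : Type*} [Field F] (M : Matrix (Fin n) (Fin n) F)
    (t : ℕ) (u : Fin n) : (Nmat M t u).det = M.det ^ t * (Nmat M 0 u).det := by
  rw [Nmat_eq_pow_mul, Matrix.det_mul, Matrix.det_pow]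

theorem vecMul_Nmat_apply {n : ℕ} {F : Type*} [Field F] (M : Matrix (Fin n) (Fin n) F)
    (t : ℕ) (u j : Fin n) (x : Fin n → F) :
    Matrix.vecMul x (Nmat M t u) j = Matrix.vecMul x (M ^ (t + (j : ℕ))) u := rfl

theorem iterate_vecMul {n : ℕ} {F : Type*} [Field F] (M : Matrix (Fin n) (Fin n) F)
    (t : ℕ) (x : Fin n → F) :
    (fun x => Matrix.vecMul x M)^[t] x = Matrix.vecMul x (M ^ t) := by
  induction t with
  | zero => simp
  | succ t ih => rw [Function.iterate_succ_apply', ih, pow_succ, Matrix.vecMul_vecMul]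

theorem expansive_vecMul_iff {n : ℕ} {F : Type*} [Field F] (M : Matrix (Fin n) (Fin n) F) :
    Expansive (fun x => Matrix.vecMul x M) ↔
      ∀ x : Fin n → F, x ≠ 0 → ∀ v, ∃ t : ℕ, 1 ≤ t ∧ Matrix.vecMul x (M ^ t) v ≠ 0 := by
  simp only [Expansive, iterate_vecMul]
  refine ⟨fun h x hx v => by simpa using h x 0 hx v, fun h x y hxy v => ?_⟩
  obtain ⟨t, ht, hne⟩ := h (x - y) (sub_ne_zero.2 hxy) v
  refine ⟨t, ht, fun he => hne ?_⟩
  rw [Matrix.sub_vecMul, Pi.sub_apply, he, sub_self]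

/-- By Cayley–Hamilton, a coordinate of the orbit of `x` that vanishes at times `0, …, n - 1`
vanishes at all times. -/
theorem vecMul_pow_apply_eq_zero {n : ℕ} (hn : 1 ≤ n) {F : Type*} [Field F]
    (M : Matrix (Fin n) (Fin n) F) (x : Fin n → F) (u : Fin n)
    (h : ∀ j < n, Matrix.vecMul x (M ^ j) u = 0) (k : ℕ) :
    Matrix.vecMul x (M ^ k) u = 0 := by
  have hdeg : (Polynomial.X ^ k %ₘ M.charpoly).natDegree < n := by
    have hc : M.charpoly.natDegree = n := by simp [Matrix.charpoly_natDegree_eq_dim]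
    refine (Polynomial.natDegree_modByMonic_lt _ M.charpoly_monic fun h1 => ?_).trans_eq hc
    rw [h1, Polynomial.natDegree_one] at hc
    omega
  rw [Matrix.pow_eq_aeval_mod_charpoly, Polynomial.aeval_eq_sum_range' hdeg,
    Matrix.vecMul_sum, Finset.sum_apply]
  refine Finset.sum_eq_zero fun j hj => ?_
  rw [Matrix.vecMul_smul, Pi.smul_apply, h j (Finset.mem_range.1 hj), smul_zero]

/-- Lemma 1: for a field linear network `f(x) = xM` over a finite field `GF(q)`
(finite fields of order `q` exist exactly for prime powers `q`), the following are
equivalent: (1) `f` is expansive; (2) `M` is nonsingular and `N_u^{(0)}` is nonsingular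
for all `u`; (3) `N_u^{(t)}` is nonsingular for all `u` and all `t ≥ 1`;
(4) there exists `t ≥ 1` such that `N_u^{(t)}` is nonsingular for all `u`. -/
theorem stmt_0 {n : ℕ} (hn : 1 ≤ n) {F : Type} [Field F] [Fintype F]
    (M : Matrix (Fin n) (Fin n) F) :
    List.TFAE
      [ Expansive (fun x => Matrix.vecMul x M),
        M.det ≠ 0 ∧ ∀ u : Fin n, (Nmat M 0 u).det ≠ 0,
        ∀ u : Fin n, ∀ t : ℕ, 1 ≤ t → (Nmat M t u).det ≠ 0,
        ∃ t : ℕ, 1 ≤ t ∧ ∀ u : Fin n, (Nmat M t u).det ≠ 0 ] := by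
  tfae_have 1 → 2 := by
    rw [expansive_vecMul_iff]
    refine fun h => ⟨fun hdet => ?_, fun u hdet => ?_⟩
    · obtain ⟨x, hx, hxM⟩ := Matrix.exists_vecMul_eq_zero_iff.2 hdet
      obtain ⟨t, ht, hne⟩ := h x hx ⟨0, hn⟩
      obtain ⟨s, rfl⟩ := Nat.exists_eq_add_of_le ht
      rw [pow_add, pow_one, ← Matrix.vecMul_vecMul, hxM, Matrix.zero_vecMul] at hne
      exact hne rfl
    · obtain ⟨x, hx, hxN⟩ := Matrix.exists_vecMul_eq_zero_iff.2 hdet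
      obtain ⟨t, -, hne⟩ := h x hx u
      refine hne (vecMul_pow_apply_eq_zero hn M x u (fun j hj => ?_) t)
      have hj0 := congrFun hxN ⟨j, hj⟩
      rwa [vecMul_Nmat_apply, Nat.zero_add] at hj0
  tfae_have 2 → 3 := fun h u t _ => by
    rw [det_Nmat]
    exact mul_ne_zero (pow_ne_zero _ h.1) (h.2 u)
  tfae_have 3 → 4 := fun h => ⟨1, le_rfl, fun u => h u 1 le_rfl⟩
  tfae_have 4 → 1 := by
    rintro ⟨t, ht, h⟩
    refine (expansive_vecMul_iff M).2 fun x hx v => ?_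
    by_contra! hzero
    refine h v (Matrix.exists_vecMul_eq_zero_iff.1 ⟨x, hx, funext fun j => ?_⟩)
    exact hzero _ (Nat.le_add_right_of_le ht)
  tfae_finish
end

section
/- If D is a coverable directed graph on n vertices, then for every integer q ≥ 3 there exists a matrix M over the ring Z_q = Z/qZ such that M_{i,j} ≠ 0 if and only if (i,j) is an arc of D, and det(M) = 1 (in particular M is nonsingular over Z_q). -/
theorem exists_ne_zero_mul_add_eq_one_or_neg_one {R : Type*} [CommRing R] (h2 : (2 : R) ≠ 0)
    {a : R} (ha : a = 1 ∨ a = -1) (s : R) :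
    ∃ d : R, d ≠ 0 ∧ (d * a + s = 1 ∨ d * a + s = -1) := by
  have haa : a * a = 1 := by rcases ha with rfl | rfl <;> ring
  by_cases h : a * (1 - s) = 0
  · refine ⟨a * (-1 - s), fun h' => h2 ?_, Or.inr ?_⟩
    · linear_combination a * h - a * h' - 2 * haa
    · linear_combination (-1 - s) * haa
  · exact ⟨a * (1 - s), h, Or.inl (by linear_combination (1 - s) * haa)⟩

/-- The determinant is an affine function of the top left entry. -/
theorem Matrix.det_cons_cons {R : Type*} [CommRing R] {n : ℕ} (d : R) (b c : Fin n → R)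
    (A : Matrix (Fin n) (Fin n) R) :
    (Matrix.of (Fin.cons (Fin.cons d b) fun i => Fin.cons (c i) (A i)) :
      Matrix (Fin (n + 1)) (Fin (n + 1)) R).det =
    d * A.det + (Matrix.of (Fin.cons (Fin.cons 0 b) fun i => Fin.cons (c i) (A i)) :
      Matrix (Fin (n + 1)) (Fin (n + 1)) R).det := by
  rw [Matrix.det_succ_row_zero, Matrix.det_succ_row_zero, Fin.sum_univ_succ, Fin.sum_univ_succ]
  have hA (e : R) : (Matrix.of (Fin.cons (Fin.cons e b) fun i => Fin.cons (c i) (A i)) :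
      Matrix (Fin (n + 1)) (Fin (n + 1)) R).submatrix Fin.succ Fin.succ = A := by
    ext i j; simp
  have hB (j : Fin (n + 1)) :
      (Matrix.of (Fin.cons (Fin.cons d b) fun i => Fin.cons (c i) (A i)) :
        Matrix (Fin (n + 1)) (Fin (n + 1)) R).submatrix Fin.succ j.succAbove =
      (Matrix.of (Fin.cons (Fin.cons 0 b) fun i => Fin.cons (c i) (A i)) :
        Matrix (Fin (n + 1)) (Fin (n + 1)) R).submatrix Fin.succ j.succAbove := by
    ext i k; simp
  simp [hA, hB]

theorem exists_matrix_det_eq_one_or_neg_one {R : Type*} [CommRing R] (h2 : (2 : R) ≠ 0)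
    (n : ℕ) (D : Fin n → Fin n → Prop) (hD : ∀ v, D v v) :
    ∃ M : Matrix (Fin n) (Fin n) R,
      (∀ i j, M i j ≠ 0 ↔ D i j) ∧ (M.det = 1 ∨ M.det = -1) := by
  classical
  have : Nontrivial R := ⟨⟨2, 0, h2⟩⟩
  induction n with
  | zero => exact ⟨1, fun i => i.elim0, Or.inl Matrix.det_one⟩
  | succ n ih =>
    obtain ⟨A, hA, hdet⟩ := ih (fun i j => D i.succ j.succ) fun v => hD v.succ
    let b : Fin n → R := fun j => if D 0 j.succ then 1 else 0
    let c : Fin n → R := fun i => if D i.succ 0 then 1 else 0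
    obtain ⟨d, hd, hd'⟩ := exists_ne_zero_mul_add_eq_one_or_neg_one h2 hdet
      (Matrix.of (Fin.cons (Fin.cons 0 b) fun i => Fin.cons (c i) (A i)) :
        Matrix (Fin (n + 1)) (Fin (n + 1)) R).det
    refine ⟨Matrix.of (Fin.cons (Fin.cons d b) fun i => Fin.cons (c i) (A i)), ?_, ?_⟩
    · intro i j
      cases i using Fin.cases <;> cases j using Fin.cases
      · simp [hd, hD]
      · simp [b]
      · simp [c]
      · simpa using hA _ _
    · rwa [Matrix.det_cons_cons]

/-- Theorem: if `D` is a coverable directed graph on `n` vertices (i.e. its vertex set is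
covered by vertex-disjoint cycles, equivalently there is a permutation `π` with
`(v, π v)` an arc for every `v`), then for every `q ≥ 3` there is a matrix `M` over
`ℤ/qℤ` whose interaction graph is exactly `D` (i.e. `M i j ≠ 0 ↔ (i,j)` is an arc)
and with `det M = 1`; in particular `M` is nonsingular. -/
theorem stmt_1 (n q : ℕ) (hq : 3 ≤ q) (D : Fin n → Fin n → Prop)
    (hcov : ∃ π : Equiv.Perm (Fin n), ∀ v : Fin n, D v (π v)) :
    ∃ M : Matrix (Fin n) (Fin n) (ZMod q),
      (∀ i j : Fin n, M i j ≠ 0 ↔ D i j) ∧ M.det = 1 := by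
  obtain ⟨π, hπ⟩ := hcov
  have h2 : (2 : ZMod q) ≠ 0 := fun h => by
    have := (ZMod.natCast_eq_zero_iff 2 q).1 (by exact_mod_cast h)
    exact absurd (Nat.le_of_dvd two_pos this) (by omega)
  obtain ⟨A, hA, hdet⟩ := exists_matrix_det_eq_one_or_neg_one h2 n (fun i j => D i (π j)) hπ
  let N := A.submatrix id π.symm
  have hN : ∀ i j, N i j ≠ 0 ↔ D i j := fun i j => by simpa [N] using hA i (π.symm j)
  have hNdet : N.det = 1 ∨ N.det = -1 := by
    rw [Matrix.det_permute']
    rcases Int.units_eq_one_or (Equiv.Perm.sign π.symm) with h | h <;>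
      rcases hdet with h' | h' <;> simp [h, h']
  rcases hNdet with h | h
  · exact ⟨N, hN, h⟩
  cases n with
  | zero => exact ⟨N, hN, Matrix.det_fin_zero⟩
  | succ n =>
    refine ⟨N.updateRow 0 ((-1 : ZMod q) • N 0), fun i j => ?_, ?_⟩
    · rw [← hN i j]
      by_cases hi : i = 0
      · subst hi; simp
      · simp [hi]
    · rw [Matrix.det_updateRow_smul, Matrix.updateRow_eq_self, h]
      ring
end

section
/- Let n ≥ 2, q ≥ 2, let f : [q]^n → [q]^n be an automata network and let D be its interaction graph. If f is quasi-expansive, then D is strong and coverable. -/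
/-- Arc `u → v` of the interaction graph of the automata network `f`:
`f_v` depends essentially on coordinate `u`. -/
def hasArc {n : ℕ} {α : Type*} (f : (Fin n → α) → (Fin n → α)) (u v : Fin n) : Prop :=
  ∃ a b : Fin n → α, (∀ w : Fin n, w ≠ u → a w = b w) ∧ f a v ≠ f b v

/-- The local function at `v` only depends on the in-neighbours of `v`. -/
theorem apply_eq_of_forall_hasArc {n : ℕ} {α : Type*} {f : (Fin n → α) → (Fin n → α)}
    {v : Fin n} {x y : Fin n → α} (h : ∀ u, hasArc f u v → x u = y u) : f x v = f y v := by
  classical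
  suffices H : ∀ (s : Finset (Fin n)) (x : Fin n → α), (∀ w, w ∉ s → x w = y w) →
      (∀ u, hasArc f u v → x u = y u) → f x v = f y v from
    H Finset.univ x (fun w hw => absurd (Finset.mem_univ w) hw) h
  intro s
  induction s using Finset.induction_on with
  | empty =>
    intro x hx _
    rw [funext fun w => hx w (Finset.notMem_empty w)]
  | insert a s _ ih =>
    intro x hx h
    have hstep : f x v = f (Function.update x a (y a)) v := by
      by_cases ha : hasArc f a v
      · rw [← h a ha, Function.update_eq_self]
      · by_contra hne
        exact ha ⟨x, _, fun w hw => (Function.update_of_ne hw _ _).symm, hne⟩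
    rw [hstep]
    refine ih _ (fun w hw => ?_) (fun u hu => ?_)
    · by_cases hwa : w = a
      · subst hwa; simp
      · rw [Function.update_of_ne hwa]
        exact hx w (by simp [hwa, hw])
    · by_cases hua : u = a
      · subst hua; simp
      · rw [Function.update_of_ne hua]
        exact h u hu

/-- Two configurations that agree on all ancestors of `v` do so along their whole orbits. -/
theorem iterate_apply_eq_of_reflTransGen {n : ℕ} {α : Type*} {f : (Fin n → α) → (Fin n → α)}
    {v : Fin n} {x y : Fin n → α} (h : ∀ u, Relation.ReflTransGen (hasArc f) u v → x u = y u)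
    (t : ℕ) {u : Fin n} (hu : Relation.ReflTransGen (hasArc f) u v) :
    f^[t] x u = f^[t] y u := by
  induction t generalizing u with
  | zero => exact h u hu
  | succ t ih =>
    rw [Function.iterate_succ_apply', Function.iterate_succ_apply']
    exact apply_eq_of_forall_hasArc fun w hw => ih (hu.head hw)

/-- If `S` has fewer out-neighbours than elements, then `f` identifies two distinct
configurations that differ only inside `S`. -/
theorem exists_ne_map_eq_of_card_out_lt {n q : ℕ} (hq : 2 ≤ q)
    {f : (Fin n → Fin q) → (Fin n → Fin q)} {S T : Finset (Fin n)}
    (hT : ∀ u ∈ S, ∀ v, hasArc f u v → v ∈ T) (hcard : T.card < S.card) :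
    ∃ x y, x ≠ y ∧ (∀ w, w ∉ S → x w = y w) ∧ f x = f y := by
  classical
  let extend : (S → Fin q) → Fin n → Fin q :=
    fun z w => if hw : w ∈ S then z ⟨w, hw⟩ else ⟨0, by omega⟩
  have hlt : Fintype.card (T → Fin q) < Fintype.card (S → Fin q) := by
    simpa using Nat.pow_lt_pow_right (by omega : 1 < q) hcard
  obtain ⟨z, z', hne, heq⟩ := Fintype.exists_ne_map_eq_of_card_lt
    (fun (z : S → Fin q) (v : T) => f (extend z) v) hlt
  have hoff : ∀ w, w ∉ S → extend z w = extend z' w := fun w hw => by simp [extend, hw]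
  refine ⟨extend z, extend z', fun h => hne ?_, hoff, ?_⟩
  · funext w
    simpa [extend] using congrFun h w
  · funext v
    by_cases hv : v ∈ T
    · exact congrFun heq ⟨v, hv⟩
    · exact apply_eq_of_forall_hasArc fun u hu => hoff u fun huS => hv (hT u huS v hu)

/-- Lemma: if an automata network `f : [q]^n → [q]^n` is quasi-expansive (for all
distinct `x, y` and every node `v`, the restrictions of `f^t(x)` and `f^t(y)` to the
in-neighbourhood of `v` differ for some `t ≥ 0`), then its interaction graph is strong
(there is a directed path between any ordered pair of vertices) and coverable (there is
a permutation `π` with an arc from `v` to `π v` for every `v`). -/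
theorem stmt_2 (n q : ℕ) (hn : 2 ≤ n) (hq : 2 ≤ q)
    (f : (Fin n → Fin q) → (Fin n → Fin q))
    (hqe : ∀ x y : Fin n → Fin q, x ≠ y → ∀ v : Fin n,
      ∃ t : ℕ, ∃ u : Fin n, hasArc f u v ∧ f^[t] x u ≠ f^[t] y u) :
    (∀ u v : Fin n, Relation.ReflTransGen (hasArc f) u v) ∧
    (∃ π : Equiv.Perm (Fin n), ∀ v : Fin n, hasArc f v (π v)) := by
  classical
  refine ⟨fun u v => ?_, ?_⟩
  · by_contra huv
    let x : Fin n → Fin q := fun _ => ⟨0, by omega⟩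
    let y : Fin n → Fin q := Function.update x u ⟨1, by omega⟩
    have hxy : x ≠ y := fun h => by simpa [x, y] using congrFun h u
    obtain ⟨t, w, hw, hne⟩ := hqe x y hxy v
    refine hne (iterate_apply_eq_of_reflTransGen (fun a ha => ?_) t (.single hw))
    have hau : a ≠ u := fun h => huv (h ▸ ha)
    simp [y, hau]
  · have hall : ∀ S : Finset (Fin n),
        S.card ≤ (Finset.univ.filter fun v => ∃ u ∈ S, hasArc f u v).card := by
      intro S
      by_contra! hlt
      obtain ⟨x, y, hne, hoff, heq⟩ := exists_ne_map_eq_of_card_out_lt hq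
        (fun u hu v huv => by simpa using ⟨u, hu, huv⟩) hlt
      have hout : ∀ v, ∃ u ∈ S, hasArc f u v := by
        intro v
        obtain ⟨t, u, hu, hne⟩ := hqe x y hne v
        cases t with
        | zero => exact ⟨u, by_contra fun huS => hne (hoff u huS), hu⟩
        | succ t =>
          rw [Function.iterate_succ_apply, Function.iterate_succ_apply, heq] at hne
          exact absurd rfl hne
      rw [Finset.filter_true_of_mem fun v _ => hout v] at hlt
      exact absurd (Finset.card_le_univ S) hlt.not_ge
    obtain ⟨π, hinj, hπ⟩ :=
      (Fintype.all_card_le_filter_rel_iff_exists_injective (hasArc f)).mp fun S => by convert hall S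
    exact ⟨Equiv.ofBijective π (Finite.injective_iff_bijective.mp hinj), hπ⟩
end

section
/- Let n ≥ 2, q ≥ 2, let f : [q]^n → [q]^n be an automata network and let D be its interaction graph. If f is weakly expansive, then D is strong and coverable. -/
/-- The value of `f` at `v` is determined by the in-neighbours of `v`. -/
theorem apply_eq_of_eq_on_inNeighbours {n : ℕ} {α : Type*} (f : (Fin n → α) → (Fin n → α))
    (v : Fin n) (a b : Fin n → α) (hab : ∀ u, hasArc f u v → a u = b u) : f a v = f b v := by
  classical
  suffices H : ∀ (T : Finset (Fin n)) (a : Fin n → α), (∀ u ∉ T, a u = b u) →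
      (∀ u, hasArc f u v → a u = b u) → f a v = f b v from
    H Finset.univ a (fun u hu => absurd (Finset.mem_univ u) hu) hab
  intro T
  induction T using Finset.induction_on with
  | empty =>
    intro a h _
    rw [funext fun u => h u (Finset.notMem_empty u)]
  | insert u T _ ih =>
    intro a hT ha
    have hupd : f a v = f (Function.update a u (b u)) v := by
      by_cases harc : hasArc f u v
      · rw [← ha u harc, Function.update_eq_self]
      · by_contra hne
        exact harc ⟨a, _, fun w hw => (Function.update_of_ne hw _ _).symm, hne⟩
    rw [hupd]
    apply ih
    · intro w hw
      by_cases hwu : w = u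
      · subst hwu; simp
      · rw [Function.update_of_ne hwu]
        exact hT w (by simp [hwu, hw])
    · intro w hw
      by_cases hwu : w = u
      · subst hwu; simp
      · rw [Function.update_of_ne hwu]
        exact ha w hw

/-- A difference at `u` propagates only to vertices reachable from `u`. -/
theorem iterate_eq_of_not_reachable {n : ℕ} {α : Type*} (f : (Fin n → α) → (Fin n → α))
    {u : Fin n} {x y : Fin n → α} (hxy : ∀ w, w ≠ u → x w = y w) (t : ℕ) :
    ∀ v, ¬ Relation.ReflTransGen (hasArc f) u v → f^[t] x v = f^[t] y v := by
  induction t with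
  | zero =>
    intro v hv
    exact hxy v fun h => hv (h ▸ Relation.ReflTransGen.refl)
  | succ t ih =>
    intro v hv
    rw [Function.iterate_succ_apply', Function.iterate_succ_apply']
    exact apply_eq_of_eq_on_inNeighbours f v _ _ fun w hw => ih w fun h => hv (h.tail hw)

/-- If `S` has more vertices than the set `N` of its out-neighbours, then `f` identifies two
distinct configurations that agree outside `S`. -/
theorem exists_ne_map_eq_of_card_lt {n q : ℕ} (hq : 2 ≤ q)
    (f : (Fin n → Fin q) → (Fin n → Fin q)) (S N : Finset (Fin n))
    (hN : ∀ u ∈ S, ∀ v, hasArc f u v → v ∈ N) (hcard : N.card < S.card) :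
    ∃ x y : Fin n → Fin q, x ≠ y ∧ f x = f y ∧ ∀ w ∉ S, x w = y w := by
  let e : (S → Fin q) → (Fin n → Fin q) :=
    fun g w => if h : w ∈ S then g ⟨w, h⟩ else ⟨0, by omega⟩
  have hlt : Fintype.card (N → Fin q) < Fintype.card (S → Fin q) := by
    simpa using Nat.pow_lt_pow_right (by omega : 1 < q) hcard
  obtain ⟨g, h, hgh, heq⟩ := Fintype.exists_ne_map_eq_of_card_lt
    (fun g : S → Fin q => fun w : N => f (e g) w) hlt
  have hout : ∀ w ∉ S, e g w = e h w := fun w hw => by simp [e, hw]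
  refine ⟨e g, e h, fun he => hgh (funext fun w => ?_), funext fun v => ?_, hout⟩
  · simpa [e] using congrFun he w
  · by_cases hv : v ∈ N
    · exact congrFun heq ⟨v, hv⟩
    · exact apply_eq_of_eq_on_inNeighbours f v _ _ fun u hu =>
        hout u fun huS => hv (hN u huS v hu)

/-- Lemma: if an automata network `f : [q]^n → [q]^n` is weakly expansive (for all
distinct `x, y` and every node `v` there exists `t ≥ 0` with `f^t(x)_v ≠ f^t(y)_v`),
then its interaction graph is strong (there is a directed path between any ordered pair
of vertices) and coverable (there is a permutation `π` with an arc from `v` to `π v`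
for every `v`). -/
theorem stmt_3 (n q : ℕ) (hn : 2 ≤ n) (hq : 2 ≤ q)
    (f : (Fin n → Fin q) → (Fin n → Fin q))
    (hwe : ∀ x y : Fin n → Fin q, x ≠ y → ∀ v : Fin n,
      ∃ t : ℕ, f^[t] x v ≠ f^[t] y v) :
    (∀ u v : Fin n, Relation.ReflTransGen (hasArc f) u v) ∧
    (∃ π : Equiv.Perm (Fin n), ∀ v : Fin n, hasArc f v (π v)) := by
  classical
  have hstrong : ∀ u v : Fin n, Relation.ReflTransGen (hasArc f) u v := by
    intro u v
    by_contra huv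
    let x : Fin n → Fin q := fun _ => ⟨0, by omega⟩
    let y : Fin n → Fin q := Function.update x u ⟨1, by omega⟩
    have hne : x ≠ y := fun h => by simpa [x, y] using congrFun h u
    obtain ⟨t, ht⟩ := hwe x y hne v
    exact ht (iterate_eq_of_not_reachable f
      (fun w hw => (Function.update_of_ne hw _ _).symm) t v huv)
  refine ⟨hstrong, ?_⟩
  have hall : ∀ S : Finset (Fin n),
      S.card ≤ (S.biUnion fun u => Finset.univ.filter fun v => hasArc f u v).card := by
    intro S
    by_contra! hcard
    obtain ⟨x, y, hxy, hf, hout⟩ := exists_ne_map_eq_of_card_lt hq f S _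
      (fun u hu v huv => Finset.mem_biUnion.2 ⟨u, hu, by simpa using huv⟩) hcard
    have hdiff : ∀ v, x v ≠ y v := by
      intro v
      obtain ⟨t, ht⟩ := hwe x y hxy v
      cases t with
      | zero => exact ht
      | succ t => simp [Function.iterate_succ_apply, hf] at ht
    have hS : ∀ w, w ∈ S := fun w => by_contra fun hw => hdiff w (hout w hw)
    refine absurd hcard (not_lt.2 (Finset.card_le_card fun v _ => ?_))
    have : Nontrivial (Fin n) := Fin.nontrivial_iff_two_le.2 hn
    obtain ⟨u, hu⟩ := exists_ne v
    rcases Relation.ReflTransGen.cases_tail (hstrong u v) with h | ⟨w, _, hw⟩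
    · exact absurd h.symm hu
    · exact Finset.mem_biUnion.2 ⟨w, hS w, by simpa using hw⟩
  obtain ⟨π, hinj, hπ⟩ :=
    (Finset.all_card_le_biUnion_card_iff_exists_injective _).1 hall
  exact ⟨Equiv.ofBijective π (Finite.injective_iff_bijective.1 hinj),
    fun v => by simpa using hπ v⟩
end

section
/- Let D be a strong and coverable directed graph on n ≥ 2 vertices. Then for every prime power q with q ≥ (n³ + n² + 4)/2 there exists a matrix M ∈ GF(q)^{n×n} such that M_{i,j} ≠ 0 if and only if (i,j) is an arc of D, and the field linear network f(x) = xM is expansive. -/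
section NetworkObservability

open Matrix

/-- `M` is *observable* at `v` on `U` if a row vector supported on `U` whose iterates
`x M, x M², …` all vanish at `v` is zero. -/
def ObservableOn {V K : Type*} [Fintype V] [DecidableEq V] [Field K] (M : Matrix V V K)
    (U : Set V) (v : V) : Prop :=
  ∀ x : V → K, (∀ i, i ∉ U → x i = 0) → (∀ k : ℕ, (x ᵥ* M ^ (k + 1)) v = 0) → x = 0

variable {V K : Type*} [Fintype V] [DecidableEq V] [Field K]

theorem vecMul_pow_of_eigenvector {M : Matrix V V K} {x : V → K} {c : K}
    (h : x ᵥ* M = c • x) (k : ℕ) : x ᵥ* M ^ k = c ^ k • x := by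
  induction k with
  | zero => simp
  | succ k ih => rw [pow_succ, ← vecMul_vecMul, ih, smul_vecMul, h, smul_smul, pow_succ]

/-- If observability fails, it is violated by an eigenvector. -/
theorem exists_eigenvector_of_not_observableOn [IsAlgClosed K] {M : Matrix V V K} {U : Set V}
    {v : V} (hM : ∀ i j, M i j ≠ 0 → j ∈ U) (h : ¬ ObservableOn M U v) :
    ∃ x : V → K, ∃ c : K, x ≠ 0 ∧ (∀ i, i ∉ U → x i = 0) ∧ x ᵥ* M = c • x ∧ c * x v = 0 := by
  simp only [ObservableOn, not_forall] at h
  obtain ⟨x₀, hx₀, hx₀v, hne⟩ := h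
  let N : Submodule K (V → K) :=
    { carrier := {x | (∀ i, i ∉ U → x i = 0) ∧ ∀ k : ℕ, (x ᵥ* M ^ (k + 1)) v = 0}
      add_mem' := by
        rintro a b ⟨ha, ha'⟩ ⟨hb, hb'⟩
        refine ⟨fun i hi => by simp [ha i hi, hb i hi], fun k => ?_⟩
        rw [add_vecMul, Pi.add_apply, ha' k, hb' k, add_zero]
      zero_mem' := by simp
      smul_mem' := by
        rintro c a ⟨ha, ha'⟩
        refine ⟨fun i hi => by simp [ha i hi], fun k => ?_⟩
        rw [smul_vecMul, Pi.smul_apply, ha' k, smul_zero] }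
  have hinv : ∀ x ∈ N, M.vecMulLinear x ∈ N := by
    rintro x ⟨-, hx'⟩
    refine ⟨fun j hj => ?_, fun k => ?_⟩
    · refine Finset.sum_eq_zero fun i _ => ?_
      have : M i j = 0 := by_contra fun h => hj (hM i j h)
      simp [this]
    · rw [vecMulLinear_apply, vecMul_vecMul, ← pow_succ']
      exact hx' (k + 1)
  have : Nontrivial N := ⟨⟨⟨x₀, hx₀, hx₀v⟩, 0, fun h => hne (congrArg Subtype.val h)⟩⟩
  obtain ⟨c, hc⟩ := Module.End.exists_eigenvalue (M.vecMulLinear.restrict hinv)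
  obtain ⟨⟨x, hxU, hxv⟩, hx⟩ := hc.exists_hasEigenvector
  have hxM : x ᵥ* M = c • x := congrArg Subtype.val hx.apply_eq_smul
  refine ⟨x, c, fun h => hx.2 (Subtype.ext h), hxU, hxM, ?_⟩
  have := hxv 0
  rwa [zero_add, pow_one, hxM] at this

open Polynomial in
/-- If an entry of the adjugate of `1 - X M` vanishes, so does that entry of all powers of `M`. -/
theorem pow_apply_eq_zero_of_adjugate {M : Matrix V V K} {u v : V}
    (h : adjugate (1 - (X : K[X]) • M.map C) u v = 0) (k : ℕ) : (M ^ k) u v = 0 := by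
  set B : Matrix V V K[X] := 1 - (X : K[X]) • M.map C with hB
  have hdet : B.det.eval 0 = 1 := by
    have : (evalRingHom (0 : K)).mapMatrix B = 1 := by
      ext i j
      simp [hB, Matrix.one_apply, apply_ite]
    rw [← coe_evalRingHom, RingHom.map_det, this, det_one]
  have hstep : adjugate B = B.det • (1 : Matrix V V K[X]) + (X : K[X]) • (adjugate B * M.map C) := by
    rw [← adjugate_mul, hB, mul_sub, mul_one, mul_smul_comm, sub_add_cancel]
  have hiter : ∀ m : ℕ, adjugate B = (∑ j ∈ Finset.range m, (B.det * X ^ j) • (M ^ j).map C)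
      + (X ^ m : K[X]) • (adjugate B * (M ^ m).map C) := by
    intro m
    induction m with
    | zero => simp [Matrix.map_one]
    | succ m ih =>
      have hmul : M.map C * (M ^ m).map C = (M ^ (m + 1)).map (C : K →+* K[X]) := by
        rw [pow_succ', Matrix.map_mul]
      conv_lhs => rw [ih]
      rw [Finset.sum_range_succ, add_assoc]
      congr 1
      conv_lhs => rw [hstep]
      rw [add_mul, smul_add, smul_mul_assoc, one_mul, smul_mul_assoc, Matrix.mul_assoc, hmul,
        smul_smul, smul_smul, ← pow_succ, mul_comm B.det]
  induction k using Nat.strong_induction_on with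
  | _ k ih =>
    have hk := congrFun (congrFun (hiter (k + 1)) u) v
    rw [h, Finset.sum_range_succ, Matrix.add_apply, Matrix.add_apply, Matrix.sum_apply,
      Finset.sum_eq_zero (fun j hj => by simp [ih j (Finset.mem_range.mp hj)])] at hk
    simp only [Matrix.smul_apply, Matrix.map_apply, smul_eq_mul, zero_add] at hk
    have hk' : X ^ k * (B.det * C ((M ^ k) u v)
        + X * (adjugate B * (M ^ (k + 1)).map C) u v) = X ^ k * 0 := by
      rw [mul_zero, hk]; ring
    have h0 := congrArg (eval 0) (mul_left_cancel₀ (pow_ne_zero k X_ne_zero) hk')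
    simpa [hdet] using h0

theorem exists_ne_zero_forall_isRoot_mul_pow_ne_one [Infinite K] {p : Polynomial K} (hp : p ≠ 0)
    {N : ℕ} (hN : 0 < N) : ∃ s : K, s ≠ 0 ∧ ∀ r, p.IsRoot r → (s * r) ^ N ≠ 1 := by
  classical
  obtain ⟨s, hs⟩ := Infinite.exists_notMem_finset (insert 0
    (Finset.image₂ (fun z r => z / r) (Polynomial.nthRoots N (1 : K)).toFinset p.roots.toFinset))
  rw [Finset.mem_insert, not_or] at hs
  refine ⟨s, hs.1, fun r hr hsr => hs.2 (Finset.mem_image₂.mpr ⟨s * r, ?_, r, ?_, ?_⟩)⟩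
  · simpa [Polynomial.mem_nthRoots hN] using hsr
  · simpa [hp] using hr
  · have hr0 : r ≠ 0 := by
      rintro rfl
      simp [hN.ne'] at hsr
    exact mul_div_cancel_right₀ s hr0

open Polynomial in
/-- Observability extends from `U` to `U ∪ C` for a cycle `C` of `π` that has an arc into `U`. -/
theorem ObservableOn.exists_extension [IsAlgClosed K] {M : Matrix V V K} {U : Set V} {v u d : V}
    (π : Equiv.Perm V) (hπ : ∀ i, π i ∈ U ↔ i ∈ U) (hM : ∀ i j, M i j ≠ 0 → i ∈ U ∧ j ∈ U)
    (hu : u ∈ U) (hd : d ∉ U) (h : ObservableOn M U v) :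
    ∃ M' : Matrix V V K,
      (∀ i j, M' i j ≠ 0 → M i j ≠ 0 ∨ (i = d ∧ j = u) ∨ (π.SameCycle d i ∧ j = π i)) ∧
      ObservableOn M' (U ∪ {i | π.SameCycle d i}) v := by
  classical
  have hC : ∀ i, π.SameCycle d i → i ∉ U := by
    intro i hi hiU
    obtain ⟨k, -, rfl⟩ := hi.exists_pow_eq'
    have : ∀ k : ℕ, (π ^ k) d ∉ U := by
      intro k
      induction k with
      | zero => simpa
      | succ k ih => rwa [pow_succ', Equiv.Perm.mul_apply, hπ]
    exact this k hiU
  have hsingle : (Pi.single u 1 : V → K) ≠ 0 := by simp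
  obtain ⟨k, hk⟩ : ∃ k : ℕ, (M ^ (k + 1)) u v ≠ 0 := by
    by_contra! hall
    refine hsingle (h _ (fun i hi => Pi.single_eq_of_ne (by rintro rfl; exact hi hu) _) fun k => ?_)
    simpa using hall k
  set B : Matrix V V K[X] := 1 - (X : K[X]) • M.map C with hB
  have hp : adjugate B u v ≠ 0 := fun h0 => hk (pow_apply_eq_zero_of_adjugate h0 _)
  obtain ⟨s, hs, hroot⟩ := exists_ne_zero_forall_isRoot_mul_pow_ne_one hp (orderOf_pos π)
  let M' : Matrix V V K := fun i j => M i j + (if i = d ∧ j = u then 1 else 0)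
    + if π.SameCycle d i ∧ j = π i then s else 0
  have hsupp : ∀ i j, M' i j ≠ 0 →
      M i j ≠ 0 ∨ (i = d ∧ j = u) ∨ (π.SameCycle d i ∧ j = π i) := by
    intro i j hij
    by_contra! hcon
    apply hij
    simp only [M']
    rw [hcon.1, if_neg (fun h => hcon.2.1 h.1 h.2), if_neg (fun h => hcon.2.2 h.1 h.2)]
    simp
  refine ⟨M', hsupp, ?_⟩
  by_contra hno
  obtain ⟨x, c, hx, hxU, hxM, hxv⟩ := exists_eigenvector_of_not_observableOn (by
    intro i j hij
    rcases hsupp i j hij with h | ⟨-, rfl⟩ | ⟨h, rfl⟩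
    · exact Or.inl (hM i j h).2
    · exact Or.inl hu
    · exact Or.inr (Equiv.Perm.sameCycle_apply_right.mpr h)) hno
  have hcoord : ∀ j, c * x j = ∑ i, x i * M' i j := fun j => (congrFun hxM j).symm
  have hcycle : ∀ i, π.SameCycle d i → s * x i = c * x (π i) := by
    intro i hi
    have hπi : π i ∉ U := fun h => hC i hi ((hπ i).mp h)
    rw [hcoord, Finset.sum_eq_single i]
    · have h1 : M i (π i) = 0 := by_contra fun h => hπi (hM _ _ h).2
      have h2 : π i ≠ u := fun h => hπi (h ▸ hu)
      simp [M', h1, h2, hi, mul_comm]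
    · intro i' _ hne
      have h1 : M i' (π i) = 0 := by_contra fun h => hπi (hM _ _ h).2
      have h2 : π i ≠ u := fun h => hπi (h ▸ hu)
      simp [M', h1, h2, hne.symm]
    · simp
  have hpow : ∀ k : ℕ, s ^ k * x d = c ^ k * x ((π ^ k) d) := by
    intro k
    induction k with
    | zero => simp
    | succ k ih =>
      have hc := hcycle ((π ^ k) d) (Equiv.Perm.sameCycle_pow_right.mpr (Equiv.Perm.SameCycle.refl π d))
      rw [pow_succ' π, Equiv.Perm.mul_apply, pow_succ', mul_assoc, ih, mul_left_comm, hc,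
        pow_succ, mul_assoc]
  -- the coordinates of the eigenvector on `U`
  have hU : ∀ j, j ∈ U → c * x j = (∑ i, x i * M i j) + if j = u then x d else 0 := by
    intro j hj
    have hzero : ∀ i, ¬ (π.SameCycle d i ∧ j = π i) :=
      fun i hi => hC i hi.1 ((hπ i).mp (hi.2 ▸ hj))
    rw [hcoord]
    simp only [M', if_neg (hzero _), add_zero, mul_add, Finset.sum_add_distrib]
    congr 1
    by_cases hju : j = u <;> simp [hju]
  by_cases hxd : x d = 0
  · have hxC : ∀ i, π.SameCycle d i → x i = 0 := by
      intro i hi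
      obtain ⟨k, -, hk⟩ := hi.symm.exists_pow_eq'
      have : ∀ (k : ℕ) (i : V), π.SameCycle d i → (π ^ k) i = d → x i = 0 := by
        intro k
        induction k with
        | zero => rintro i - rfl; simpa using hxd
        | succ k ih =>
          intro i hi hk
          have := hcycle i hi
          rw [ih (π i) (Equiv.Perm.sameCycle_apply_right.mpr hi)
            (by rwa [pow_succ, Equiv.Perm.mul_apply] at hk), mul_zero] at this
          exact (mul_eq_zero.mp this).resolve_left hs
      exact this k i hi hk
    have hxU' : ∀ i, i ∉ U → x i = 0 := fun i hi =>
      if hc : π.SameCycle d i then hxC i hc else hxU i (fun h => h.elim hi hc)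
    have hxM' : x ᵥ* M = c • x := by
      ext j
      rw [Pi.smul_apply, smul_eq_mul]
      by_cases hj : j ∈ U
      · rw [hU j hj, hxd, ite_self, add_zero]; rfl
      · rw [hxU' j hj, mul_zero]
        exact Finset.sum_eq_zero fun i _ =>
          mul_eq_zero_of_right _ (by_contra fun h => hj (hM i j h).2)
    refine hx (h x hxU' fun k => ?_)
    rw [vecMul_pow_of_eigenvector hxM', Pi.smul_apply, smul_eq_mul, pow_succ, mul_assoc, hxv,
      mul_zero]
  · have hN : s ^ orderOf π = c ^ orderOf π := by
      have := hpow (orderOf π)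
      rw [pow_orderOf_eq_one, Equiv.Perm.one_apply] at this
      exact mul_right_cancel₀ hxd this
    have hc : c ≠ 0 := by
      rintro rfl
      rw [zero_pow (orderOf_pos π).ne'] at hN
      exact pow_ne_zero _ hs hN
    have hxv0 : x v = 0 := (mul_eq_zero.mp hxv).resolve_left hc
    refine hroot c⁻¹ ?_ (by rw [mul_pow, hN, inv_pow, mul_inv_cancel₀ (pow_ne_zero _ hc)])
    let y : V → K := fun i => if i ∈ U then x i else 0
    have hyM : y ᵥ* M = c • y - x d • Pi.single u 1 := by
      ext j
      have hsum : (y ᵥ* M) j = ∑ i, x i * M i j := by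
        refine Finset.sum_congr rfl fun i _ => ?_
        by_cases hi : i ∈ U
        · simp [y, hi]
        · have : M i j = 0 := by_contra fun h => hi (hM i j h).1
          simp [this]
      rw [hsum]
      by_cases hj : j ∈ U
      · rw [Pi.sub_apply, Pi.smul_apply, smul_eq_mul]
        simp only [y, if_pos hj, hU j hj]
        by_cases hju : j = u <;> simp [hju]
      · have hju : j ≠ u := fun h => hj (h ▸ hu)
        have h0 : ∑ i, x i * M i j = 0 := Finset.sum_eq_zero fun i _ => by
          rw [by_contra fun h => hj (hM i j h).2, mul_zero]
        simp [h0, y, hj, hju]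
    have hA : (evalRingHom c⁻¹).mapMatrix B = 1 - c⁻¹ • M := by
      ext i j
      simp [hB, Matrix.one_apply, apply_ite, mul_comm (M i j)]
    have hyB : y ᵥ* (1 - c⁻¹ • M) = (c⁻¹ * x d) • Pi.single u 1 := by
      rw [vecMul_sub, vecMul_one, vecMul_smul, hyM, smul_sub, smul_smul, inv_mul_cancel₀ hc,
        one_smul, sub_sub_cancel, smul_smul]
    have hadj := congrArg (fun z => (z ᵥ* adjugate (1 - c⁻¹ • M)) v) hyB
    simp only [vecMul_vecMul, mul_adjugate, vecMul_smul, vecMul_one, smul_vecMul,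
      Pi.smul_apply, smul_eq_mul, single_one_vecMul] at hadj
    have hyv : y v = 0 := by simp [y, hxv0]
    rw [hyv, mul_zero, ← hA, ← RingHom.map_adjugate] at hadj
    have := (mul_eq_zero.mp hadj.symm).resolve_left (mul_ne_zero (inv_ne_zero hc) hxd)
    simpa [Polynomial.IsRoot] using this

/-- Over an algebraically closed field, every strong coverable digraph carries weights for which
the network is observable at a given vertex. -/
theorem exists_observableOn_univ [IsAlgClosed K] {D : V → V → Prop}
    (hstrong : ∀ u v, Relation.ReflTransGen D u v) (π : Equiv.Perm V) (hπ : ∀ v, D v (π v))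
    (v : V) : ∃ M : Matrix V V K, (∀ i j, M i j ≠ 0 → D i j) ∧ ObservableOn M Set.univ v := by
  classical
  let P : Set (Set V) := {U | v ∈ U ∧ (∀ i, π i ∈ U ↔ i ∈ U) ∧ ∃ M : Matrix V V K,
    (∀ i j, M i j ≠ 0 → D i j ∧ i ∈ U ∧ j ∈ U) ∧ ObservableOn M U v}
  have hbase : {i | π.SameCycle v i} ∈ P := by
    refine ⟨Equiv.Perm.SameCycle.refl π v, fun i => Equiv.Perm.sameCycle_apply_right,
      fun i j => if π.SameCycle v i ∧ j = π i then 1 else 0, ?_, ?_⟩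
    · intro i j hij
      obtain ⟨hi, rfl⟩ : π.SameCycle v i ∧ j = π i := by_contra fun h => hij (if_neg h)
      exact ⟨hπ i, hi, Equiv.Perm.sameCycle_apply_right.mpr hi⟩
    · intro x hx hxv
      set M : Matrix V V K := fun i j => if π.SameCycle v i ∧ j = π i then 1 else 0 with hM
      have hshift : ∀ z : V → K, ∀ i, π.SameCycle v i → (z ᵥ* M) (π i) = z i := by
        intro z i hi
        change ∑ i', z i' * M i' (π i) = z i
        rw [Finset.sum_eq_single i]
        · simp [hM, hi]
        · intro i' _ hne
          simp [hM, hne.symm]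
        · simp
      have hiter : ∀ k i, π.SameCycle v i → (x ᵥ* M ^ k) ((π ^ k) i) = x i := by
        intro k
        induction k with
        | zero => simp
        | succ k ih =>
          intro i hi
          rw [pow_succ, ← vecMul_vecMul, pow_succ', Equiv.Perm.mul_apply,
            hshift _ _ (Equiv.Perm.sameCycle_pow_right.mpr hi), ih i hi]
      ext i
      by_cases hi : π.SameCycle v i
      · obtain ⟨k, hk0, -, hk⟩ := hi.symm.exists_pow_eq''
        obtain ⟨k, rfl⟩ := Nat.exists_eq_succ_of_ne_zero hk0.ne'
        rw [← hiter (k + 1) i hi, hk]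
        exact hxv k
      · exact hx i hi
  obtain ⟨U, hUP, hmax⟩ := (Set.toFinite P).exists_maximal ⟨_, hbase⟩
  obtain ⟨hv, hUπ, M, hM, hobs⟩ := hUP
  suffices hU : U = Set.univ from ⟨M, fun i j h => (hM i j h).1, hU ▸ hobs⟩
  by_contra hU
  obtain ⟨w, hw⟩ := (Set.ne_univ_iff_exists_notMem U).mp hU
  obtain ⟨d, u, hd, hu, hdu⟩ : ∃ d u, d ∉ U ∧ u ∈ U ∧ D d u := by
    by_contra! hcon
    have : ∀ z, Relation.ReflTransGen D w z → z ∉ U := by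
      intro z hz
      induction hz with
      | refl => exact hw
      | tail _ hab ih => exact fun hb => hcon _ _ ih hb hab
    exact this v (hstrong w v) hv
  obtain ⟨M', hM', hobs'⟩ := hobs.exists_extension π hUπ (fun i j h => (hM i j h).2) hu hd
  have hmem : U ∪ {i | π.SameCycle d i} ∈ P := by
    refine ⟨Or.inl hv, fun i => or_congr (hUπ i) Equiv.Perm.sameCycle_apply_right, M', ?_, hobs'⟩
    intro i j hij
    rcases hM' i j hij with h | ⟨rfl, rfl⟩ | ⟨h, rfl⟩
    · exact ⟨(hM i j h).1, Or.inl (hM i j h).2.1, Or.inl (hM i j h).2.2⟩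
    · exact ⟨hdu, Or.inr (Equiv.Perm.SameCycle.refl π _), Or.inl hu⟩
    · exact ⟨hπ i, Or.inr h, Or.inr (Equiv.Perm.sameCycle_apply_right.mpr h)⟩
  exact hd (hmax hmem Set.subset_union_left (Or.inr (Equiv.Perm.SameCycle.refl π d)))

/-- The matrix whose columns are the columns `v` of `M, M², …, Mⁿ`. -/
def krylovMatrix {R : Type*} [CommRing R] {n : ℕ} (M : Matrix (Fin n) (Fin n) R) (v : Fin n) :
    Matrix (Fin n) (Fin n) R :=
  fun i k => (M ^ (k.val + 1)) i v

theorem vecMul_krylovMatrix {n : ℕ} (M : Matrix (Fin n) (Fin n) K) (v k : Fin n)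
    (x : Fin n → K) : (x ᵥ* krylovMatrix M v) k = (x ᵥ* M ^ (k.val + 1)) v :=
  rfl

theorem RingHom.map_det_krylovMatrix {R S : Type*} [CommRing R] [CommRing S] {n : ℕ} (f : R →+* S)
    (M : Matrix (Fin n) (Fin n) R) (v : Fin n) :
    f (krylovMatrix M v).det = (krylovMatrix (f.mapMatrix M) v).det := by
  rw [RingHom.map_det]
  congr 1
  ext i k
  change f ((M ^ _) i v) = (f.mapMatrix M ^ _) i v
  rw [← map_pow]
  rfl

theorem ObservableOn.det_krylovMatrix_ne_zero {n : ℕ} {M : Matrix (Fin n) (Fin n) K} {v : Fin n}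
    (h : ObservableOn M Set.univ v) : (krylovMatrix M v).det ≠ 0 := by
  intro hdet
  obtain ⟨x, hx, hxK⟩ := exists_vecMul_eq_zero_iff.mpr hdet
  refine hx (h x (by simp) fun k => ?_)
  have hlt : (Polynomial.X ^ k %ₘ M.charpoly).natDegree < n := by
    have hn : M.charpoly.natDegree = n := by simp
    refine (Polynomial.natDegree_modByMonic_lt _ M.charpoly_monic fun h1 => ?_).trans_eq hn
    rw [h1, Polynomial.natDegree_one] at hn
    exact absurd v.isLt (by omega)
  rw [pow_succ, pow_eq_aeval_mod_charpoly, Polynomial.aeval_eq_sum_range' hlt, Finset.sum_mul,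
    vecMul_sum, Finset.sum_apply]
  refine Finset.sum_eq_zero fun i hi => ?_
  have := congrFun hxK ⟨i, Finset.mem_range.mp hi⟩
  rw [vecMul_krylovMatrix] at this
  rw [smul_mul_assoc, ← pow_succ, vecMul_smul, Pi.smul_apply, this, Pi.zero_apply, smul_zero]

theorem expansive_vecMul_of_det_krylovMatrix_ne_zero {n : ℕ} {M : Matrix (Fin n) (Fin n) K}
    (h : ∀ v, (krylovMatrix M v).det ≠ 0) : Expansive (fun x => x ᵥ* M) := by
  have hiter : ∀ (t : ℕ) (x : Fin n → K), (fun x => x ᵥ* M)^[t] x = x ᵥ* M ^ t := by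
    intro t x
    induction t with
    | zero => simp
    | succ t ih => rw [Function.iterate_succ_apply', ih, vecMul_vecMul, pow_succ]
  intro x y hxy v
  by_contra! hcon
  refine h v (exists_vecMul_eq_zero_iff.mp ⟨x - y, sub_ne_zero.mpr hxy, ?_⟩)
  ext k
  have := hcon (k.val + 1) (by omega)
  rw [hiter, hiter] at this
  rw [vecMul_krylovMatrix, sub_vecMul, Pi.sub_apply, this, sub_self, Pi.zero_apply]

open MvPolynomial in
theorem totalDegree_pow_apply_le {σ R : Type*} [CommRing R] {M : Matrix V V (MvPolynomial σ R)}
    (h : ∀ i j, (M i j).totalDegree ≤ 1) (k : ℕ) (i j : V) :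
    ((M ^ k) i j).totalDegree ≤ k := by
  induction k generalizing j with
  | zero =>
    rw [pow_zero, Matrix.one_apply]
    split_ifs <;> simp
  | succ k ih =>
    rw [pow_succ, Matrix.mul_apply]
    exact totalDegree_finsetSum_le fun l _ =>
      (totalDegree_mul _ _).trans (add_le_add (ih l) (h l j))

open MvPolynomial in
theorem totalDegree_det_krylovMatrix_le {σ R : Type*} [CommRing R] {n : ℕ}
    {M : Matrix (Fin n) (Fin n) (MvPolynomial σ R)} (h : ∀ i j, (M i j).totalDegree ≤ 1)
    (v : Fin n) : (krylovMatrix M v).det.totalDegree ≤ ∑ k : Fin n, (k.val + 1) := by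
  rw [det_apply]
  refine totalDegree_finsetSum_le fun σ _ => ?_
  have hprod : (∏ k, krylovMatrix M v (σ k) k).totalDegree ≤ ∑ k : Fin n, (k.val + 1) :=
    (totalDegree_finsetProd _ _).trans
      (Finset.sum_le_sum fun k _ => totalDegree_pow_apply_le h _ _ _)
  rcases Int.units_eq_one_or (Equiv.Perm.sign σ) with hs | hs <;> simpa [hs] using hprod

end NetworkObservability

/-- Theorem: every strong and coverable directed graph `D` on `n ≥ 2` vertices admits an
expansive linear network over the finite field `GF(q)` whenever
`q ≥ (n³ + n² + 4)/2` (stated as `n³ + n² + 4 ≤ 2q`, where `q` is the cardinality of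
the finite field `F`): there is a matrix `M ∈ F^{n×n}` whose support is exactly the
arc set of `D` and such that `x ↦ xM` is expansive. -/
theorem stmt_4 (n : ℕ) (hn : 2 ≤ n) (F : Type) [Field F] [Fintype F]
    (hq : n ^ 3 + n ^ 2 + 4 ≤ 2 * Fintype.card F)
    (D : Fin n → Fin n → Prop)
    (hstrong : ∀ u v : Fin n, Relation.ReflTransGen D u v)
    (hcov : ∃ π : Equiv.Perm (Fin n), ∀ v : Fin n, D v (π v)) :
    ∃ M : Matrix (Fin n) (Fin n) F,
      (∀ i j : Fin n, M i j ≠ 0 ↔ D i j) ∧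
      Expansive (fun x => Matrix.vecMul x M) := by
  classical
  obtain ⟨π, hπ⟩ := hcov
  let A : Matrix (Fin n) (Fin n) (MvPolynomial (Fin n × Fin n) F) :=
    Matrix.of fun i j => if D i j then MvPolynomial.X (i, j) else 0
  have hAdeg : ∀ i j, (A i j).totalDegree ≤ 1 := by
    intro i j
    simp only [A, Matrix.of_apply]
    split_ifs <;> simp
  have hdet : ∀ v, (krylovMatrix A v).det ≠ 0 := by
    intro v h0
    obtain ⟨M, hM, hobs⟩ := exists_observableOn_univ (K := AlgebraicClosure F) hstrong π hπ v
    let φ : MvPolynomial (Fin n × Fin n) F →+* AlgebraicClosure F :=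
      (MvPolynomial.aeval fun p : Fin n × Fin n => M p.1 p.2).toRingHom
    have hφ : φ.mapMatrix A = M := by
      ext i j
      by_cases hij : D i j
      · simp [A, φ, hij]
      · have : M i j = 0 := by_contra fun h => hij (hM i j h)
        simp [A, hij, this]
    refine hobs.det_krylovMatrix_ne_zero ?_
    rw [← hφ, ← RingHom.map_det_krylovMatrix, h0, map_zero]
  let P : MvPolynomial (Fin n × Fin n) F := ∏ v, (krylovMatrix A v).det
  have hP : P ≠ 0 := Finset.prod_ne_zero_iff.mpr fun v _ => hdet v
  have hsum : 2 * ∑ k : Fin n, (k.val + 1) = n * (n + 1) := by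
    rw [Fin.sum_univ_eq_sum_range (fun k => k + 1), ← Nat.add_zero (∑ i ∈ _, _),
      ← Finset.sum_range_succ' (fun k => k), mul_comm, Finset.sum_range_id_mul_two]
    simp [mul_comm]
  have hPdeg : 2 * P.totalDegree ≤ n ^ 3 + n ^ 2 := by
    have h1 : P.totalDegree ≤ n * ∑ k : Fin n, (k.val + 1) := by
      refine (MvPolynomial.totalDegree_finsetProd _ _).trans
        ((Finset.sum_le_sum fun v _ => totalDegree_det_krylovMatrix_le hAdeg v).trans_eq ?_)
      simp
    calc 2 * P.totalDegree ≤ n * (2 * ∑ k : Fin n, (k.val + 1)) := by linarith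
      _ = n ^ 3 + n ^ 2 := by rw [hsum]; ring
  obtain ⟨x, hx, hxP⟩ : ∃ x : Fin n × Fin n → F, (∀ p, x p ≠ 0) ∧ MvPolynomial.eval x P ≠ 0 := by
    by_contra! hcon
    refine hP (MvPolynomial.eq_zero_of_eval_zero_at_prod_finset P
      (fun _ => Finset.univ.erase 0) (fun p => ?_) fun x hx => hcon x fun p => ?_)
    · have := MvPolynomial.degreeOf_le_totalDegree P p
      rw [Finset.card_erase_of_mem (Finset.mem_univ _), Finset.card_univ]
      omega
    · exact Finset.ne_of_mem_erase (hx p)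
  refine ⟨(MvPolynomial.eval x).mapMatrix A, fun i j => ?_,
    expansive_vecMul_of_det_krylovMatrix_ne_zero fun v => ?_⟩
  · by_cases hij : D i j <;> simp [A, hij, hx]
  · rw [map_prod] at hxP
    rw [← RingHom.map_det_krylovMatrix]
    exact Finset.prod_ne_zero_iff.mp hxP v (Finset.mem_univ v)
end

section
/- Let n ≥ 2, let S ⊆ [n], and let D be the cycle with loops on vertex set [n] with loop set S, i.e. the directed graph with arc set {(i, i+1) : 1 ≤ i ≤ n, indices mod n} ∪ {(s,s) : s ∈ S}. If S ≠ [n], then for every q ≥ 2 there exists a matrix M over Z_q = Z/qZ with M_{i,j} ≠ 0 iff (i,j) is an arc of D such that the linear network x ↦ xM is expansive. If S = [n], then such an M exists for every q ≥ 3, but for q = 2 no such M exists. -/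
/-- The *cycle with loops* on vertex set `Fin n` with loop set `S`:
arcs `(i, i+1)` (indices mod `n`) for all `i`, together with a loop at each `s ∈ S`. -/
def cycleWithLoops (n : ℕ) (S : Set (Fin n)) : Fin n → Fin n → Prop :=
  fun i j => (j : ℕ) = ((i : ℕ) + 1) % n ∨ (j = i ∧ i ∈ S)

/-- The matrix over `R` whose row-vector action sends `x` to `j ↦ x (j - 1) + d j * x j`
(indices mod `m + 1`). -/
def loopMatrix {R : Type*} [Ring R] {m : ℕ} (d : Fin (m + 1) → R) :
    Matrix (Fin (m + 1)) (Fin (m + 1)) R :=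
  fun i j => (if i = j - 1 then 1 else 0) + (if i = j then d j else 0)

theorem vecMul_loopMatrix {R : Type*} [CommRing R] {m : ℕ} (d x : Fin (m + 1) → R)
    (j : Fin (m + 1)) :
    Matrix.vecMul x (loopMatrix d) j = x (j - 1) + d j * x j := by
  simp [Matrix.vecMul, dotProduct, loopMatrix, mul_add, Finset.sum_add_distrib, mul_comm]

theorem cycleWithLoops_succ_iff {m : ℕ} (S : Set (Fin (m + 1))) (i j : Fin (m + 1)) :
    cycleWithLoops (m + 1) S i j ↔ i = j - 1 ∨ (i = j ∧ j ∈ S) := by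
  have h : (j : ℕ) = ((i : ℕ) + 1) % (m + 1) ↔ i = j - 1 := by
    rw [eq_sub_iff_add_eq, Fin.ext_iff, Fin.val_add, Fin.val_one', Nat.add_mod_mod]
    exact eq_comm
  unfold cycleWithLoops
  rw [h]
  refine or_congr Iff.rfl ⟨?_, ?_⟩
  · rintro ⟨rfl, hS⟩
    exact ⟨rfl, hS⟩
  · rintro ⟨rfl, hS⟩
    exact ⟨rfl, hS⟩

theorem loopMatrix_ne_zero_iff {R : Type*} [Ring R] [Nontrivial R] {m : ℕ} (hm : 1 ≤ m)
    (S : Set (Fin (m + 1))) (d : Fin (m + 1) → R) (hd : ∀ j, d j ≠ 0 ↔ j ∈ S)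
    (i j : Fin (m + 1)) :
    loopMatrix d i j ≠ 0 ↔ cycleWithLoops (m + 1) S i j := by
  have : NeZero m := ⟨by omega⟩
  have h1 : j - 1 ≠ j := by simp [sub_eq_self]
  rw [cycleWithLoops_succ_iff, ← hd j, loopMatrix]
  by_cases h : i = j - 1
  · simp [h, h1]
  · by_cases h' : i = j <;> simp [h, h', h1.symm]

/-- A property of one residue mod `m + 1` that passes to predecessors holds for all residues. -/
theorem Fin.forall_of_pred {m : ℕ} {P : Fin (m + 1) → Prop} (v : Fin (m + 1)) (hv : P v)
    (h : ∀ j, P j → P (j - 1)) (j : Fin (m + 1)) : P j := by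
  have key : ∀ k : Fin (m + 1), P (v - k) := by
    intro k
    induction k using Fin.induction with
    | zero => simpa using hv
    | succ k ih =>
      have := h _ ih
      rwa [sub_sub, Fin.coeSucc_eq_succ] at this
  simpa using key (v - j)

theorem expansive_loopMatrix {R : Type*} [CommRing R] {m : ℕ} (d : Fin (m + 1) → R)
    (hd : ∀ z : Fin (m + 1) → R, (∀ j, z (j - 1) + d j * z j = 0) → z = 0) :
    Expansive (fun x => Matrix.vecMul x (loopMatrix d)) := by
  intro x y hxy v
  by_contra! hcon
  set f : (Fin (m + 1) → R) → (Fin (m + 1) → R) := fun x => Matrix.vecMul x (loopMatrix d)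
  have hf (x j) : f x j = x (j - 1) + d j * x j :=
    vecMul_loopMatrix d x j
  have key : ∀ j, ∀ t, 1 ≤ t → f^[t] x j = f^[t] y j := by
    refine Fin.forall_of_pred v hcon fun j hj t ht => ?_
    have h := hj (t + 1) (by omega)
    rw [Function.iterate_succ_apply', Function.iterate_succ_apply', hf, hf, hj t ht] at h
    exact add_right_cancel h
  refine hxy (sub_eq_zero.mp (hd (x - y) fun j => ?_))
  have h := key j 1 le_rfl
  rw [Function.iterate_one, hf, hf] at h
  simp only [Pi.sub_apply]
  linear_combination h

/-- Proposition: let `D` be the cycle with loops on `[n]` (`n ≥ 2`) with loop set `S`.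
If `S ≠ [n]` (proper case), then for every `q ≥ 2` there is a matrix `M` over `ℤ/qℤ`
whose support is exactly the arc set of `D` and such that `x ↦ xM` is expansive.
If `S = [n]` (improper case), such an `M` exists for every `q ≥ 3` but not for `q = 2`. -/
theorem stmt_8 (n : ℕ) (hn : 2 ≤ n) (S : Set (Fin n)) :
    (S ≠ Set.univ →
      ∀ q : ℕ, 2 ≤ q →
        ∃ M : Matrix (Fin n) (Fin n) (ZMod q),
          (∀ i j : Fin n, M i j ≠ 0 ↔ cycleWithLoops n S i j) ∧
          Expansive (fun x => Matrix.vecMul x M)) ∧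
    (S = Set.univ →
      (∀ q : ℕ, 3 ≤ q →
        ∃ M : Matrix (Fin n) (Fin n) (ZMod q),
          (∀ i j : Fin n, M i j ≠ 0 ↔ cycleWithLoops n S i j) ∧
          Expansive (fun x => Matrix.vecMul x M)) ∧
      ¬ ∃ M : Matrix (Fin n) (Fin n) (ZMod 2),
          (∀ i j : Fin n, M i j ≠ 0 ↔ cycleWithLoops n S i j) ∧
          Expansive (fun x => Matrix.vecMul x M)) := by
  obtain ⟨m, rfl⟩ : ∃ m, n = m + 1 := ⟨n - 1, by omega⟩
  have hm : 1 ≤ m := by omega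
  refine ⟨fun hS q hq => ?_, ?_⟩
  · have : Fact (1 < q) := ⟨hq⟩
    obtain ⟨v, hv⟩ := (Set.ne_univ_iff_exists_notMem S).mp hS
    classical
    refine ⟨loopMatrix fun j => if j ∈ S then 1 else 0,
      loopMatrix_ne_zero_iff hm S _ fun j => by simp, expansive_loopMatrix _ fun z hz => ?_⟩
    refine funext (Fin.forall_of_pred (v - 1) (by simpa [hv] using hz v) fun j hj => ?_)
    simpa [hj] using hz j
  · rintro rfl
    refine ⟨fun q hq => ?_, ?_⟩
    · have : Fact (1 < q) := ⟨by omega⟩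
      have h2 : (2 : ZMod q) ≠ 0 := fun h => by
        have := Nat.le_of_dvd two_pos ((ZMod.natCast_eq_zero_iff 2 q).mp (by exact_mod_cast h))
        omega
      have hsq : ((-1 : ZMod q) ^ m) * (-1) ^ m = 1 := by
        rw [← mul_pow]; simp
      refine ⟨loopMatrix fun j => if j = 0 then -((-1) ^ m * 2) else 1,
        loopMatrix_ne_zero_iff hm _ _ fun j => ?_, expansive_loopMatrix _ fun z hz => ?_⟩
      · by_cases hj : j = 0
        · simp only [hj, if_true, Set.mem_univ, iff_true]
          intro h
          exact h2 (by linear_combination -(-1) ^ m * h - 2 * hsq)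
        · simp [hj]
      · have hpow : ∀ i : Fin (m + 1), z i = (-1) ^ (i : ℕ) * z 0 := by
          intro i
          induction i using Fin.induction with
          | zero => simp
          | succ i ih =>
            have h := hz i.succ
            have hi : i.succ - 1 = i.castSucc := by
              rw [sub_eq_iff_eq_add, Fin.coeSucc_eq_succ]
            rw [hi, ih, if_neg (Fin.succ_ne_zero i), Fin.val_castSucc] at h
            rw [Fin.val_succ, pow_succ]
            linear_combination h
        have h0 : z 0 = 0 := by
          have h := hz 0
          have hl : (0 : Fin (m + 1)) - 1 = Fin.last m := by
            rw [sub_eq_iff_eq_add, Fin.last_add_one]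
          rw [hl, hpow (Fin.last m), Fin.val_last, if_pos rfl] at h
          linear_combination -(-1) ^ m * h - z 0 * hsq
        funext i
        rw [hpow i, h0, mul_zero, Pi.zero_apply]
    · rintro ⟨M, hM, hexp⟩
      have hMeq : M = loopMatrix fun _ => 1 := by
        ext i j
        have h := (hM i j).trans
          (loopMatrix_ne_zero_iff hm Set.univ (fun _ => (1 : ZMod 2)) (by simp) i j).symm
        generalize M i j = a at h ⊢
        generalize loopMatrix (fun _ => (1 : ZMod 2)) i j = b at h ⊢
        revert a b
        decide
      have hker : Matrix.vecMul (1 : Fin (m + 1) → ZMod 2) M = Matrix.vecMul 0 M := by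
        funext j
        rw [hMeq, vecMul_loopMatrix, vecMul_loopMatrix]
        simp only [Pi.one_apply, Pi.zero_apply]
        decide
      obtain ⟨t, ht, hne⟩ := hexp 1 0 one_ne_zero 0
      obtain ⟨s, rfl⟩ : ∃ s, t = s + 1 := ⟨t - 1, by omega⟩
      apply hne
      rw [Function.iterate_succ_apply, Function.iterate_succ_apply]
      simp only [hker]
end
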